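/- For every ε ∈ (0,1/2) and every δ > 0 there exists N such that for all n ≥ N and all integers t with 1 ≤ t ≤ n: |X1(n,t)| < 2^{(H(ε)+ε+δ)·n·t}·F(n−t), where H(ε) = −ε·log ε − (1−ε)·log(1−ε) is the binary entropy function (log base 2). -/

import Mathlib

open Filter

noncomputable section

/-- A colored graph on `Fin n`: a simple graph whose edges are partitioned
into red and blue edges. -/
structure ColoredGraph (n : ℕ) where
  red : SimpleGraph (Fin n)
  blue : SimpleGraph (Fin n)
  disj : ∀ x y, ¬ (red.Adj x y ∧ blue.Adj x y)

namespace ColoredGraph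

variable {n : ℕ}

/-- The underlying (uncolored) simple graph. -/
def graph (G : ColoredGraph n) : SimpleGraph (Fin n) := G.red ⊔ G.blue

/-- Adjacency in a colored graph. -/
def Adj (G : ColoredGraph n) (x y : Fin n) : Prop := G.graph.Adj x y

/-- The neighborhood of a vertex. -/
def nbhd (G : ColoredGraph n) (x : Fin n) : Set (Fin n) := {y | G.Adj x y}

/-- `Γ(Q)`, the external neighborhood of a set of vertices. -/
def nbhdSet (G : ColoredGraph n) (Q : Set (Fin n)) : Set (Fin n) :=
  (⋃ x ∈ Q, G.nbhd x) \ Q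

/-- The degree of a vertex. -/
def deg (G : ColoredGraph n) (x : Fin n) : ℕ := (G.nbhd x).ncard

open scoped Classical in
/-- Indicator that the edge `xy` is blue. -/
def blueInd (G : ColoredGraph n) (x y : Fin n) : ℕ := if G.blue.Adj x y then 1 else 0

/-- Odd-blue-triangle-free: no triangle with an odd number of blue edges. -/
def OBTF (G : ColoredGraph n) : Prop :=
  ∀ x y z : Fin n, G.Adj x y → G.Adj y z → G.Adj x z →
    ¬ Odd (G.blueInd x y + G.blueInd y z + G.blueInd x z)

/-- The colored graph induced on the vertex set `A` is blue-bipartite: there is a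
partition `U ⊔ (A \ U)` of `A` such that blue edges within `A` cross the partition
and red edges within `A` do not. -/
def BlueBipartiteOn (G : ColoredGraph n) (A : Set (Fin n)) : Prop :=
  ∃ U ⊆ A, ∀ x ∈ A, ∀ y ∈ A,
    (G.blue.Adj x y → (x ∈ U ↔ y ∉ U)) ∧ (G.red.Adj x y → (x ∈ U ↔ y ∈ U))

/-- Blue-bipartite colored graph. -/
def BlueBipartite (G : ColoredGraph n) : Prop := G.BlueBipartiteOn Set.univ

/-- `κ(G)`: the minimum size of a vertex set whose removal leaves a blue-bipartite graph. -/
def kappa (G : ColoredGraph n) : ℕ :=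
  sInf {k | ∃ K : Set (Fin n), K.ncard = k ∧ G.BlueBipartiteOn Kᶜ}

end ColoredGraph

/-- `𝓕(n)`: the set of OBTF colored graphs on `[n]`. -/
def obtfSet (n : ℕ) : Set (ColoredGraph n) := {G | G.OBTF}

/-- `F(n) = |𝓕(n)|`. -/
def Fnum (n : ℕ) : ℕ := (obtfSet n).ncard

/-- `𝓑(n)`: the set of blue-bipartite colored graphs on `[n]`. -/
def bbSet (n : ℕ) : Set (ColoredGraph n) := {G | G.BlueBipartite}

/-- `|𝓑(n)|`. -/
def Bnum (n : ℕ) : ℕ := (bbSet n).ncard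

/-- `b(n) = 2^{n(n+1)/2 - 1}`. -/
def bnum (n : ℕ) : ℕ := 2 ^ (n * (n + 1) / 2 - 1)

/-- The binary entropy function (logarithms base 2). -/
def binH (x : ℝ) : ℝ := -x * Real.logb 2 x - (1 - x) * Real.logb 2 (1 - x)

/-- `K1(G)`: the set of vertices of degree less than `ε n`. -/
def K1 {n : ℕ} (G : ColoredGraph n) (ε : ℝ) : Set (Fin n) :=
  {x | (G.deg x : ℝ) < ε * n}

/-- `κ1(G) = |K1(G)|`. -/
def kappa1 {n : ℕ} (G : ColoredGraph n) (ε : ℝ) : ℕ := (K1 G ε).ncard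

/-- `X1(n,t)`: OBTF graphs with `κ1(G) ≥ t`. -/
def X1set (n t : ℕ) (ε : ℝ) : Set (ColoredGraph n) :=
  {G ∈ obtfSet n | t ≤ kappa1 G ε}

theorem cg_ext {n : ℕ} {G G' : ColoredGraph n} (h1 : G.red = G'.red) (h2 : G.blue = G'.blue) :
    G = G' := by
  cases G; cases G'; simp_all

instance cgFinite (n : ℕ) : Finite (ColoredGraph n) :=
  Finite.of_injective (fun G : ColoredGraph n => (G.red, G.blue)) (by
    intro G G' h
    simp only [Prod.mk.injEq] at h
    exact cg_ext h.1 h.2)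

/-- Induced colored graph along an embedding. -/
def pullG {m n : ℕ} (g : Fin m ↪ Fin n) (G : ColoredGraph n) : ColoredGraph m where
  red := G.red.comap g
  blue := G.blue.comap g
  disj := fun x y h => G.disj (g x) (g y) h

theorem pullG_obtf {m n : ℕ} (g : Fin m ↪ Fin n) (G : ColoredGraph n) (h : G.OBTF) :
    (pullG g G).OBTF := fun x y z hxy hyz hxz => h (g x) (g y) (g z) hxy hyz hxz

open scoped Classical in
/-- Color code of a pair. -/
def codeG {n : ℕ} (G : ColoredGraph n) (x y : Fin n) : Fin 3 :=
  if G.red.Adj x y then 1 else if G.blue.Adj x y then 2 else 0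

theorem codeG_red {n : ℕ} (G : ColoredGraph n) (x y : Fin n) :
    G.red.Adj x y ↔ codeG G x y = 1 := by
  unfold codeG; split_ifs <;> simp_all

theorem codeG_blue {n : ℕ} (G : ColoredGraph n) (x y : Fin n) :
    G.blue.Adj x y ↔ codeG G x y = 2 := by
  have := G.disj x y
  unfold codeG; split_ifs <;> simp_all

theorem codeG_adj {n : ℕ} (G : ColoredGraph n) (x y : Fin n) :
    G.Adj x y ↔ codeG G x y ≠ 0 := by
  unfold codeG ColoredGraph.Adj ColoredGraph.graph
  split_ifs <;> simp_all

/-- Rows with small support. -/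
def rowP (n : ℕ) (ε : ℝ) : Set (Fin n → Fin 3) :=
  {f | ((Finset.univ.filter (fun i => f i ≠ 0)).card : ℝ) < ε * n}

theorem codeG_row {n : ℕ} (G : ColoredGraph n) (ε : ℝ) (x : Fin n) (hx : x ∈ K1 G ε) :
    codeG G x ∈ rowP n ε := by
  have h : G.deg x = (Finset.univ.filter (fun i => codeG G x i ≠ 0)).card := by
    rw [ColoredGraph.deg, ← Set.ncard_coe_finset]
    congr 1
    ext y
    simp [ColoredGraph.nbhd, codeG_adj]
  have hx' : (G.deg x : ℝ) < ε * n := hx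
  rw [h] at hx'
  exact hx'

theorem rowP_card (n : ℕ) (ε : ℝ) (h0 : 0 < ε) (h1 : ε < 1 / 2) :
    ((rowP n ε).ncard : ℝ) ≤ (2 : ℝ) ^ ((binH ε + ε) * n) := by
  classical
  set w : Fin 3 → ℝ := fun a => if a ≠ 0 then ε / 2 else 1 - ε with hw
  have hw0 : ∀ a, 0 < w a := by
    intro a
    simp only [hw]
    split_ifs <;> linarith
  have hsum : ∑ f : Fin n → Fin 3, ∏ i, w (f i) = 1 := by
    have := (Finset.prod_univ_sum (fun _ : Fin n => (Finset.univ : Finset (Fin 3)))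
      (fun _ a => w a)).symm
    rw [Fintype.piFinset_univ] at this
    rw [this]
    have h3 : ∑ a : Fin 3, w a = 1 := by
      simp [hw, Fin.sum_univ_three]
      ring
    simp [h3]
  have hlow : ∀ f ∈ rowP n ε, (2 : ℝ) ^ (-((binH ε + ε) * n)) ≤ ∏ i, w (f i) := by
    intro f hf
    have hf' : ((Finset.univ.filter (fun i => f i ≠ 0)).card : ℝ) < ε * n := hf
    have hc := Finset.card_filter_add_card_filter_not (s := (Finset.univ : Finset (Fin n)))
      (fun i => f i ≠ 0)
    simp only [hw]
    rw [Finset.prod_ite, Finset.prod_const, Finset.prod_const]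
    rw [Finset.card_univ, Fintype.card_fin] at hc
    set k := (Finset.univ.filter (fun i => f i ≠ 0)).card
    set l := (Finset.univ.filter (fun i => ¬ f i ≠ 0)).card
    have hcr : (l : ℝ) = n - k := by rw [← hc]; push_cast; ring
    have he2 : ε / 2 = (2 : ℝ) ^ (Real.logb 2 ε - 1) := by
      rw [Real.rpow_sub_one (by norm_num), Real.rpow_logb (by norm_num) (by norm_num) h0]
    have he3 : 1 - ε = (2 : ℝ) ^ (Real.logb 2 (1 - ε)) := by
      rw [Real.rpow_logb (by norm_num) (by norm_num) (by linarith)]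
    rw [he2]
    conv_rhs => rw [he3]
    rw [← Real.rpow_natCast, ← Real.rpow_natCast, ← Real.rpow_mul (by norm_num),
      ← Real.rpow_mul (by norm_num), ← Real.rpow_add (by norm_num)]
    apply Real.rpow_le_rpow_of_exponent_le (by norm_num)
    rw [hcr, binH]
    have hl : Real.logb 2 ε ≤ Real.logb 2 (1 - ε) :=
      Real.logb_le_logb_of_le (by norm_num) h0 (by linarith)
    nlinarith [mul_nonneg (sub_nonneg.2 hf'.le) (sub_nonneg.2 hl)]
  have hfin : (rowP n ε).ncard = (Set.toFinset (rowP n ε)).card := Set.ncard_eq_toFinset_card' _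
  have hA : ((rowP n ε).ncard : ℝ) * (2 : ℝ) ^ (-((binH ε + ε) * n)) ≤ 1 := by
    rw [← hsum, hfin, ← nsmul_eq_mul]
    refine (Finset.card_nsmul_le_sum _ (fun f => ∏ i, w (f i)) _ ?_).trans ?_
    · intro f hf
      exact hlow f (by simpa using hf)
    · exact Finset.sum_le_sum_of_subset_of_nonneg (Finset.subset_univ _)
        (fun f _ _ => Finset.prod_nonneg fun i _ => (hw0 _).le)
  rw [Real.rpow_neg (by norm_num), ← div_eq_mul_inv, div_le_one (by positivity)] at hA
  exact hA

theorem Xe_card {n t : ℕ} (ε : ℝ) (e : Fin t ↪ Fin n) :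
    ({G : ColoredGraph n | G.OBTF ∧ ∀ i, e i ∈ K1 G ε}).ncard ≤
      Fnum (n - t) * (rowP n ε).ncard ^ t := by
  classical
  have hs : ((Finset.univ.map e)ᶜ : Finset (Fin n)).card = n - t := by
    simp [Finset.card_compl]
  let g : Fin (n - t) ↪ Fin n := (Finset.orderEmbOfFin _ hs).toEmbedding
  have hg : ∀ x, (∃ i, e i = x) ∨ ∃ j, g j = x := by
    intro x
    by_cases hx : ∃ i, e i = x
    · exact Or.inl hx
    · right
      have h2 : x ∈ Set.range (Finset.orderEmbOfFin _ hs) := by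
        rw [Finset.range_orderEmbOfFin]
        simpa using hx
      exact h2
  have hR : (Set.univ.pi (fun _ : Fin t => rowP n ε)).ncard = (rowP n ε).ncard ^ t := by
    rw [← Nat.card_coe_set_eq, Nat.card_congr (Equiv.Set.univPi _), Nat.card_pi]
    rw [Finset.prod_const, Finset.card_univ, Fintype.card_fin, Nat.card_coe_set_eq]
  rw [Fnum, ← hR, ← Set.ncard_prod]
  refine Set.ncard_le_ncard_of_injOn (fun G => (pullG g G, fun i => codeG G (e i))) ?_ ?_
    (Set.toFinite _)
  · rintro G ⟨h1, h2⟩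
    exact ⟨pullG_obtf g G h1, fun i _ => codeG_row G ε _ (h2 i)⟩
  · rintro G - G' - h
    simp only [Prod.mk.injEq] at h
    obtain ⟨h1, h2⟩ := h
    have h3 : ∀ i y, codeG G (e i) y = codeG G' (e i) y := fun i y =>
      congrFun (congrFun h2 i) y
    have hr : ∀ a b, G.red.Adj (g a) (g b) ↔ G'.red.Adj (g a) (g b) := by
      intro a b
      have : (pullG g G).red.Adj a b ↔ (pullG g G').red.Adj a b := by rw [h1]
      exact this
    have hb : ∀ a b, G.blue.Adj (g a) (g b) ↔ G'.blue.Adj (g a) (g b) := by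
      intro a b
      have : (pullG g G).blue.Adj a b ↔ (pullG g G').blue.Adj a b := by rw [h1]
      exact this
    apply cg_ext
    · ext x y
      rcases hg x with ⟨i, rfl⟩ | ⟨a, rfl⟩
      · rw [codeG_red, codeG_red, h3]
      rcases hg y with ⟨i, rfl⟩ | ⟨b, rfl⟩
      · rw [SimpleGraph.adj_comm, codeG_red, SimpleGraph.adj_comm, codeG_red, h3]
      exact hr a b
    · ext x y
      rcases hg x with ⟨i, rfl⟩ | ⟨a, rfl⟩
      · rw [codeG_blue, codeG_blue, h3]
      rcases hg y with ⟨i, rfl⟩ | ⟨b, rfl⟩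
      · rw [SimpleGraph.adj_comm, codeG_blue, SimpleGraph.adj_comm, codeG_blue, h3]
      exact hb a b

theorem Fnum_pos (n : ℕ) : 0 < Fnum n := by
  rw [Fnum, Set.ncard_pos (Set.toFinite _)]
  refine ⟨⟨⊥, ⊥, by simp⟩, ?_⟩
  intro x y z h
  simp [ColoredGraph.Adj, ColoredGraph.graph] at h

theorem X1_card_le (n t : ℕ) (ε : ℝ) :
    (X1set n t ε).ncard ≤ n ^ t * (Fnum (n - t) * (rowP n ε).ncard ^ t) := by
  classical
  have hsub : X1set n t ε ⊆ ⋃ e ∈ (Finset.univ : Finset (Fin t ↪ Fin n)),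
      {G : ColoredGraph n | G.OBTF ∧ ∀ i, e i ∈ K1 G ε} := by
    rintro G ⟨h1, h2⟩
    have h2' : t ≤ (K1 G ε).ncard := h2
    obtain ⟨S, hS, hc⟩ := Set.exists_subset_card_eq h2'
    have hc' : S.toFinset.card = t := by rw [← Set.ncard_eq_toFinset_card', hc]
    simp only [Set.mem_iUnion]
    refine ⟨(Finset.orderEmbOfFin _ hc').toEmbedding, Finset.mem_univ _, h1, fun i => hS ?_⟩
    have := Finset.orderEmbOfFin_mem _ hc' i
    exact Set.mem_toFinset.1 this
  refine (Set.ncard_le_ncard hsub (Set.toFinite _)).trans ?_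
  refine (Finset.set_ncard_biUnion_le _ _).trans ?_
  refine (Finset.sum_le_card_nsmul _ _ _ (fun e _ => Xe_card ε e)).trans ?_
  rw [smul_eq_mul, Finset.card_univ, Fintype.card_embedding_eq, Fintype.card_fin, Fintype.card_fin]
  exact Nat.mul_le_mul_right _ (Nat.descFactorial_le_pow _ _)

theorem n_lt_rpow (δ : ℝ) (hδ : 0 < δ) : ∃ N : ℕ, ∀ n : ℕ, N ≤ n → (n : ℝ) < (2 : ℝ) ^ (δ * n) := by
  have h := tendsto_pow_const_div_const_pow_of_one_lt 1
    (Real.one_lt_rpow (by norm_num : (1 : ℝ) < 2) hδ)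
  obtain ⟨N, hN⟩ := eventually_atTop.1 (h.eventually_lt_const (zero_lt_one))
  refine ⟨N, fun n hn => ?_⟩
  have := hN n hn
  rw [pow_one, div_lt_one (by positivity)] at this
  rwa [Real.rpow_mul (by norm_num), Real.rpow_natCast]

/-- Lemma 3.3: for every `ε ∈ (0,1/2)` and `δ > 0`, for large `n` and any `1 ≤ t ≤ n`,
`|X1(n,t)| < 2^{(H(ε)+ε+δ) n t} F(n-t)`. -/
theorem X1_count (ε δ : ℝ) (hε0 : 0 < ε) (hε1 : ε < 1 / 2) (hδ : 0 < δ) :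
    ∃ N : ℕ, ∀ n : ℕ, N ≤ n → ∀ t : ℕ, 1 ≤ t → t ≤ n →
      ((X1set n t ε).ncard : ℝ) <
        (2 : ℝ) ^ ((binH ε + ε + δ) * n * t) * Fnum (n - t) := by
  obtain ⟨N, hN⟩ := n_lt_rpow δ hδ
  refine ⟨N, fun n hn t ht _ => ?_⟩
  have hF : (0 : ℝ) < Fnum (n - t) := by exact_mod_cast Fnum_pos _
  have h1 : ((X1set n t ε).ncard : ℝ) ≤ n ^ t * (Fnum (n - t) * (rowP n ε).ncard ^ t) := by
    exact_mod_cast X1_card_le n t ε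
  have h2 := rowP_card n ε hε0 hε1
  have h3 : (n : ℝ) ^ t < ((2 : ℝ) ^ (δ * n)) ^ t :=
    pow_lt_pow_left₀ (hN n hn) (by positivity) (by omega)
  have h4 : ((rowP n ε).ncard : ℝ) ^ t ≤ ((2 : ℝ) ^ ((binH ε + ε) * n)) ^ t := by gcongr
  calc ((X1set n t ε).ncard : ℝ) ≤ n ^ t * (Fnum (n - t) * (rowP n ε).ncard ^ t) := h1
    _ ≤ n ^ t * (Fnum (n - t) * ((2 : ℝ) ^ ((binH ε + ε) * n)) ^ t) := by gcongr
    _ < ((2 : ℝ) ^ (δ * n)) ^ t * (Fnum (n - t) * ((2 : ℝ) ^ ((binH ε + ε) * n)) ^ t) := by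
        gcongr
    _ = (2 : ℝ) ^ ((binH ε + ε + δ) * n * t) * Fnum (n - t) := by
        rw [← Real.rpow_natCast, ← Real.rpow_natCast, ← Real.rpow_mul (by norm_num),
          ← Real.rpow_mul (by norm_num)]
        have : (binH ε + ε + δ) * n * t = δ * n * t + (binH ε + ε) * n * t := by ring
        rw [this, Real.rpow_add (by norm_num)]
        ring
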